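/- arXiv:1805.06175 — 3 statements merged into one kernel-verified Lean document; each statement's English description precedes it below -/
import Mathlib

section
/- (Heller's criterion.) Let C be a pretriangulated category with all finite biproducts, and let X and Y be objects of C. Then [X] = [Y] in K₀(C) if and only if there exist objects A, B, S of C and distinguished triangles A ⟶ X ⊕ S ⟶ B ⟶ A⟦1⟧ and A ⟶ Y ⊕ S ⟶ B ⟶ A⟦1⟧. -/
open CategoryTheory CategoryTheory.Limits CategoryTheory.Pretriangulated

universe v u

variable (C : Type u) [Category.{v} C] [HasZeroObject C] [Preadditive C]
  [HasShift C ℤ] [∀ n : ℤ, (shiftFunctor C n).Additive] [Pretriangulated C]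

/-- The isomorphism class of an object. -/
def isoCls (X : C) : Quotient (isIsomorphicSetoid C) :=
  Quotient.mk (isIsomorphicSetoid C) X

/-- The subgroup of relations defining `K₀` of a pretriangulated category:
for every distinguished triangle `X₁ ⟶ X₂ ⟶ X₃ ⟶ X₁⟦1⟧` we impose
`[X₂] = [X₁] + [X₃]`. -/
def K0Rels : AddSubgroup (FreeAbelianGroup (Quotient (isIsomorphicSetoid C))) :=
  AddSubgroup.closure
    { x | ∃ T : Triangle C, (T ∈ distTriang C) ∧
        x = FreeAbelianGroup.of (isoCls C T.obj₂) - FreeAbelianGroup.of (isoCls C T.obj₁) -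
          FreeAbelianGroup.of (isoCls C T.obj₃) }

/-- `K₀` of a pretriangulated category: the free abelian group on isomorphism classes
of objects, modulo the relation `[X₂] = [X₁] + [X₃]` for every distinguished triangle. -/
abbrev K0 : Type u :=
  FreeAbelianGroup (Quotient (isIsomorphicSetoid C)) ⧸ K0Rels C

/-- The class of an object of `C` in `K₀ C`. -/
def K0.mk (X : C) : K0 C :=
  QuotientAddGroup.mk (FreeAbelianGroup.of (isoCls C X))

section HellerRelation

open scoped ZeroObject

variable {C}

theorem isoCls_eq_iff {D : Type*} [Category* D] {X Y : D} :
    isoCls D X = isoCls D Y ↔ Nonempty (X ≅ Y) :=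
  Quotient.eq (r := isIsomorphicSetoid D)

noncomputable instance isoClsAdd : Add (Quotient (isIsomorphicSetoid C)) where
  add := Quotient.map₂ (fun X Y => X ⊞ Y)
    fun _ _ ⟨e⟩ _ _ ⟨e'⟩ => ⟨biprod.mapIso e e'⟩

noncomputable instance isoClsZero : Zero (Quotient (isIsomorphicSetoid C)) where
  zero := isoCls C 0

/-- Isomorphism classes of objects form a commutative monoid under biproducts. -/
noncomputable instance isoClsAddCommMonoid :
    AddCommMonoid (Quotient (isIsomorphicSetoid C)) where
  add_assoc := by
    rintro ⟨X⟩ ⟨Y⟩ ⟨Z⟩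
    exact isoCls_eq_iff.2 ⟨biprod.associator X Y Z⟩
  zero_add := by
    rintro ⟨X⟩
    exact isoCls_eq_iff.2 ⟨(isoZeroBiprod (isZero_zero C)).symm⟩
  add_zero := by
    rintro ⟨X⟩
    exact isoCls_eq_iff.2 ⟨(isoBiprodZero (isZero_zero C)).symm⟩
  add_comm := by
    rintro ⟨X⟩ ⟨Y⟩
    exact isoCls_eq_iff.2 ⟨biprod.braiding X Y⟩
  nsmul := nsmulRec

/-- Three isomorphism classes fit into a distinguished triangle `a ⟶ m ⟶ b ⟶ a⟦1⟧`. -/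
def IsExtensionClass (a m b : Quotient (isIsomorphicSetoid C)) : Prop :=
  ∃ T ∈ distTriang C, isoCls C T.obj₁ = a ∧ isoCls C T.obj₂ = m ∧ isoCls C T.obj₃ = b

theorem isExtensionClass_iff {A M B : C} :
    IsExtensionClass (isoCls C A) (isoCls C M) (isoCls C B) ↔
      ∃ (f : A ⟶ M) (g : M ⟶ B) (h : B ⟶ A⟦(1 : ℤ)⟧), Triangle.mk f g h ∈ distTriang C := by
  constructor
  · rintro ⟨T, hT, h₁, h₂, h₃⟩
    obtain ⟨e₁⟩ := isoCls_eq_iff.1 h₁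
    obtain ⟨e₂⟩ := isoCls_eq_iff.1 h₂
    obtain ⟨e₃⟩ := isoCls_eq_iff.1 h₃
    refine ⟨e₁.inv ≫ T.mor₁ ≫ e₂.hom, e₂.inv ≫ T.mor₂ ≫ e₃.hom,
      e₃.inv ≫ T.mor₃ ≫ e₁.hom⟦1⟧', isomorphic_distinguished _ hT _ ?_⟩
    have c₁ : (e₁.inv ≫ T.mor₁ ≫ e₂.hom) ≫ e₂.inv = e₁.inv ≫ T.mor₁ := by simp
    have c₂ : (e₂.inv ≫ T.mor₂ ≫ e₃.hom) ≫ e₃.inv = e₂.inv ≫ T.mor₂ := by simp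
    have c₃ : (e₃.inv ≫ T.mor₃ ≫ e₁.hom⟦1⟧') ≫ e₁.inv⟦1⟧' = e₃.inv ≫ T.mor₃ := by
      simp [← Functor.map_comp]
    exact Triangle.isoMk _ _ e₁.symm e₂.symm e₃.symm c₁ c₂ c₃
  · rintro ⟨f, g, h, hT⟩
    exact ⟨_, hT, rfl, rfl, rfl⟩

theorem isoCls_piObj (f : WalkingPair → C) :
    isoCls C (∏ᶜ f) = isoCls C (f .left) + isoCls C (f .right) :=
  isoCls_eq_iff.2
    ⟨HasLimit.isoOfNatIso (diagramIsoPair (Discrete.functor f)) ≪≫ (biprod.isoProd _ _).symm⟩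

theorem IsExtensionClass.add {a m b a' m' b' : Quotient (isIsomorphicSetoid C)}
    (h : IsExtensionClass a m b) (h' : IsExtensionClass a' m' b') :
    IsExtensionClass (a + a') (m + m') (b + b') := by
  obtain ⟨T, hT, rfl, rfl, rfl⟩ := h
  obtain ⟨T', hT', rfl, rfl, rfl⟩ := h'
  let F : WalkingPair → Triangle C := fun j => WalkingPair.casesOn j T T'
  refine ⟨productTriangle F, productTriangle_distinguished F ?_,
    isoCls_piObj _, isoCls_piObj _, isoCls_piObj _⟩
  rintro (_ | _)
  exacts [hT, hT']

theorem isExtensionClass_add (a b : Quotient (isIsomorphicSetoid C)) :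
    IsExtensionClass a (a + b) b := by
  obtain ⟨A⟩ := a
  obtain ⟨B⟩ := b
  exact ⟨_, binaryBiproductTriangle_distinguished A B, rfl, rfl, rfl⟩

variable (C) in
/-- Heller's congruence: `x` and `y` are related if, after adding a common summand, they are
extensions of the same two objects. -/
def hellerCon : AddCon (Quotient (isIsomorphicSetoid C)) where
  r x y := ∃ a b s, IsExtensionClass a (x + s) b ∧ IsExtensionClass a (y + s) b
  iseqv :=
    { refl := fun x => ⟨x, 0, 0, isExtensionClass_add _ _, isExtensionClass_add _ _⟩
      symm := fun ⟨a, b, s, h, h'⟩ => ⟨a, b, s, h', h⟩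
      trans := by
        rintro x y z ⟨a, b, s, h₁, h₂⟩ ⟨a', b', s', h₃, h₄⟩
        refine ⟨a + a', b + b', y + s + s', ?_, ?_⟩
        · convert h₁.add h₃ using 1
          abel
        · convert h₂.add h₄ using 1
          abel }
  add' := by
    rintro w x y z ⟨a, b, s, h₁, h₂⟩ ⟨a', b', s', h₃, h₄⟩
    refine ⟨a + a', b + b', s + s', ?_, ?_⟩
    · convert h₁.add h₃ using 1
      abel
    · convert h₂.add h₄ using 1
      abel

theorem hellerCon_iff {x y : Quotient (isIsomorphicSetoid C)} :
    hellerCon C x y ↔ ∃ a b s, IsExtensionClass a (x + s) b ∧ IsExtensionClass a (y + s) b :=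
  Iff.rfl

theorem IsExtensionClass.hellerCon_add {a m b : Quotient (isIsomorphicSetoid C)}
    (h : IsExtensionClass a m b) : hellerCon C m (a + b) :=
  ⟨a, b, 0, by rwa [add_zero], by rw [add_zero]; exact isExtensionClass_add a b⟩

instance isCancelAdd_hellerCon_quotient : IsCancelAdd (hellerCon C).Quotient :=
  have : IsLeftCancelAdd (hellerCon C).Quotient := ⟨by
    rintro ⟨x⟩ ⟨y⟩ ⟨z⟩ h
    obtain ⟨a, b, s, h₁, h₂⟩ := (AddCon.eq (hellerCon C)).1 h
    refine (AddCon.eq (hellerCon C)).2 ⟨a, b, x + s, ?_, ?_⟩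
    · convert h₁ using 1
      change _ = x + y + s
      abel
    · convert h₂ using 1
      change _ = x + z + s
      abel⟩
  AddCommMagma.IsLeftCancelAdd.toIsCancelAdd _

variable (C) in
/-- The comparison homomorphism from `K₀` to the Grothendieck group of the monoid of
isomorphism classes modulo Heller's congruence. -/
noncomputable def k0ToHeller : K0 C →+ Algebra.GrothendieckAddGroup (hellerCon C).Quotient :=
  QuotientAddGroup.lift (K0Rels C)
    (FreeAbelianGroup.lift fun x => Algebra.GrothendieckAddGroup.of ((hellerCon C).mk' x)) <| by
    refine (AddSubgroup.closure_le _).2 ?_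
    rintro _ ⟨T, hT, rfl⟩
    have h : (hellerCon C).mk' (isoCls C T.obj₂) =
        (hellerCon C).mk' (isoCls C T.obj₁ + isoCls C T.obj₃) :=
      (AddCon.eq _).2 (IsExtensionClass.hellerCon_add ⟨T, hT, rfl, rfl, rfl⟩)
    simp only [SetLike.mem_coe, AddMonoidHom.mem_ker, map_sub, FreeAbelianGroup.lift_apply_of, h,
      map_add]
    abel

theorem k0ToHeller_mk (X : C) : k0ToHeller C (K0.mk C X) =
    Algebra.GrothendieckAddGroup.of ((hellerCon C).mk' (isoCls C X)) :=
  FreeAbelianGroup.lift_apply_of _ _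

theorem hellerCon_of_mk_eq {X Y : C} (h : K0.mk C X = K0.mk C Y) :
    hellerCon C (isoCls C X) (isoCls C Y) := by
  have h' := congrArg (k0ToHeller C) h
  rw [k0ToHeller_mk, k0ToHeller_mk] at h'
  exact (AddCon.eq _).1 (Algebra.GrothendieckAddGroup.of_injective h')

theorem K0.mk_obj₂ {T : Triangle C} (hT : T ∈ distTriang C) :
    K0.mk C T.obj₂ = K0.mk C T.obj₁ + K0.mk C T.obj₃ := by
  have h := (QuotientAddGroup.eq_zero_iff (N := K0Rels C) _).2
    (AddSubgroup.subset_closure ⟨T, hT, rfl⟩)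
  rw [sub_sub] at h
  exact sub_eq_zero.1 h

theorem K0.mk_biprod (X Y : C) : K0.mk C (X ⊞ Y) = K0.mk C X + K0.mk C Y :=
  K0.mk_obj₂ (binaryBiproductTriangle_distinguished X Y)

end HellerRelation

/-- Heller's criterion: `[X] = [Y]` in `K₀ C` iff there are distinguished triangles
`A ⟶ X ⊕ S ⟶ B ⟶ A⟦1⟧` and `A ⟶ Y ⊕ S ⟶ B ⟶ A⟦1⟧`. -/
theorem hellers_criterion [HasFiniteBiproducts C] (X Y : C) :
    K0.mk C X = K0.mk C Y ↔
      ∃ (A B S : C) (f : A ⟶ X ⊞ S) (g : X ⊞ S ⟶ B) (h : B ⟶ A⟦(1 : ℤ)⟧)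
        (f' : A ⟶ Y ⊞ S) (g' : Y ⊞ S ⟶ B) (h' : B ⟶ A⟦(1 : ℤ)⟧),
        (Triangle.mk f g h ∈ distTriang C) ∧ Triangle.mk f' g' h' ∈ distTriang C := by
  constructor
  · intro h
    obtain ⟨⟨A⟩, ⟨B⟩, ⟨S⟩, h₁, h₂⟩ := hellerCon_iff.1 (hellerCon_of_mk_eq h)
    obtain ⟨f, g, k, hT⟩ := (isExtensionClass_iff (M := X ⊞ S)).1 h₁
    obtain ⟨f', g', k', hT'⟩ := (isExtensionClass_iff (M := Y ⊞ S)).1 h₂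
    exact ⟨A, B, S, f, g, k, f', g', k', hT, hT'⟩
  · rintro ⟨A, B, S, f, g, k, f', g', k', hT, hT'⟩
    have h : K0.mk C (X ⊞ S) = K0.mk C (Y ⊞ S) := (K0.mk_obj₂ hT).trans (K0.mk_obj₂ hT').symm
    rw [K0.mk_biprod, K0.mk_biprod] at h
    exact add_right_cancel h
end

section
/- Let {C_i}_{i ∈ I} be an arbitrary family of pretriangulated categories, and equip the product category ∏_{i ∈ I} C_i with the componentwise pretriangulated structure (componentwise shift, a triangle being distinguished if and only if each of its components is distinguished). Then the natural group homomorphism K₀(∏_{i ∈ I} C_i) ⟶ ∏_{i ∈ I} K₀(C_i), induced by the projection functors, is an isomorphism. -/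
open CategoryTheory CategoryTheory.Limits CategoryTheory.Pretriangulated

universe v u

variable (C : Type u) [Category.{v} C] [HasZeroObject C] [Preadditive C]
  [HasShift C ℤ] [∀ n : ℤ, (shiftFunctor C n).Additive] [Pretriangulated C]

universe w

namespace K0

open scoped ZeroObject

variable {C}

theorem isoCls_eq_iff {D : Type*} [Category D] {X Y : D} :
    isoCls D X = isoCls D Y ↔ Nonempty (X ≅ Y) :=
  Quotient.eq

theorem mk_eq_of_iso {X Y : C} (e : X ≅ Y) : mk C X = mk C Y := by
  rw [mk, isoCls_eq_iff.2 ⟨e⟩, mk]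

theorem mk_triangle {T : Triangle C} (hT : T ∈ distTriang C) :
    mk C T.obj₂ = mk C T.obj₁ + mk C T.obj₃ := by
  have h : FreeAbelianGroup.of (isoCls C T.obj₂) - FreeAbelianGroup.of (isoCls C T.obj₁) -
      FreeAbelianGroup.of (isoCls C T.obj₃) ∈ K0Rels C :=
    AddSubgroup.subset_closure ⟨T, hT, rfl⟩
  have h' := (QuotientAddGroup.eq_zero_iff _).2 h
  rw [QuotientAddGroup.mk_sub, QuotientAddGroup.mk_sub, sub_sub, sub_eq_zero] at h'
  exact h'

theorem mk_biprod_s4 (X Y : C) : mk C (X ⊞ Y) = mk C X + mk C Y :=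
  mk_triangle (binaryBiproductTriangle_distinguished X Y)

theorem mk_zero : mk C (0 : C) = 0 := by
  have h : mk C (0 : C) = mk C (0 : C) + mk C (0 : C) :=
    mk_triangle (contractible_distinguished (0 : C))
  simpa using h

theorem mk_shift (X : C) : mk C (X⟦(1 : ℤ)⟧) = -mk C X := by
  have h : mk C (0 : C) = mk C X + mk C (X⟦(1 : ℤ)⟧) :=
    mk_triangle (contractible_distinguished₂ X)
  rw [mk_zero] at h
  exact (neg_eq_of_add_eq_zero_right h.symm).symm

/-- Every element of `K₀` is the class of an object. -/
theorem mk_surjective : Function.Surjective (mk C) := by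
  intro x
  obtain ⟨x, rfl⟩ := QuotientAddGroup.mk_surjective x
  induction x using FreeAbelianGroup.induction_on with
  | zero => exact ⟨0, mk_zero⟩
  | of a =>
    obtain ⟨X, rfl⟩ := Quotient.exists_rep a
    exact ⟨X, rfl⟩
  | neg a h =>
    obtain ⟨X, hX⟩ := h
    exact ⟨X⟦(1 : ℤ)⟧, by rw [mk_shift, hX, QuotientAddGroup.mk_neg]⟩
  | add x y hx hy =>
    obtain ⟨X, hX⟩ := hx
    obtain ⟨Y, hY⟩ := hy
    exact ⟨X ⊞ Y, by rw [mk_biprod_s4, hX, hY, QuotientAddGroup.mk_add]⟩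

/-- The homomorphism out of `K₀` induced by an additive invariant of isomorphism classes. -/
def lift {G : Type*} [AddCommGroup G] (f : Quotient (isIsomorphicSetoid C) → G)
    (hf : ∀ T ∈ distTriang C,
      f (isoCls C T.obj₂) = f (isoCls C T.obj₁) + f (isoCls C T.obj₃)) : K0 C →+ G :=
  QuotientAddGroup.lift _ (FreeAbelianGroup.lift f) <| by
    rw [K0Rels, AddSubgroup.closure_le]
    rintro _ ⟨T, hT, rfl⟩
    simp [hf T hT]

@[simp]
theorem lift_mk {G : Type*} [AddCommGroup G] (f : Quotient (isIsomorphicSetoid C) → G)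
    (hf : ∀ T ∈ distTriang C,
      f (isoCls C T.obj₂) = f (isoCls C T.obj₁) + f (isoCls C T.obj₃)) (X : C) :
    lift f hf (mk C X) = f (isoCls C X) :=
  FreeAbelianGroup.lift_apply_of f _

variable (C) in
/-- The direct sum of isomorphism classes of objects. -/
noncomputable abbrev isoClsAdd : Add (Quotient (isIsomorphicSetoid C)) where
  add := Quotient.map₂ (fun X Y => X ⊞ Y)
    fun _ _ ⟨e⟩ _ _ ⟨e'⟩ => ⟨biprod.mapIso e e'⟩

variable (C) in
/-- The isomorphism class of the zero object. -/
noncomputable abbrev isoClsZero : Zero (Quotient (isIsomorphicSetoid C)) where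
  zero := isoCls C 0

attribute [local instance] isoClsAdd isoClsZero

variable (C) in
/-- The monoid of isomorphism classes of objects under direct sum. -/
noncomputable abbrev isoClsAddCommMonoid : AddCommMonoid (Quotient (isIsomorphicSetoid C)) where
  add_assoc := by
    rintro ⟨X⟩ ⟨Y⟩ ⟨Z⟩
    exact Quotient.sound ⟨biprod.associator X Y Z⟩
  add_comm := by
    rintro ⟨X⟩ ⟨Y⟩
    exact Quotient.sound ⟨biprod.braiding X Y⟩
  zero_add := by
    rintro ⟨X⟩
    exact Quotient.sound ⟨(isoZeroBiprod (isZero_zero C)).symm⟩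
  add_zero := by
    rintro ⟨X⟩
    exact Quotient.sound ⟨(isoBiprodZero (isZero_zero C)).symm⟩
  nsmul := nsmulRec

attribute [local instance] isoClsAddCommMonoid

theorem isoCls_biprod (X Y : C) : isoCls C (X ⊞ Y) = isoCls C X + isoCls C Y := rfl

theorem isoCls_pi_walkingPair (f : WalkingPair → C) :
    isoCls C (∏ᶜ f) = isoCls C (f .left) + isoCls C (f .right) := by
  rw [← isoCls_biprod, isoCls_eq_iff]
  refine ⟨⟨biprod.lift (Pi.π f .left) (Pi.π f .right),
    Pi.lift fun j => WalkingPair.casesOn j biprod.fst biprod.snd, ?_, ?_⟩⟩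
  · ext (_ | _) <;> simp
  · ext <;> simp

variable (C) in
/-- The classes `a`, `x`, `b` are those of the objects of a distinguished triangle. -/
def IsExtension (a x b : Quotient (isIsomorphicSetoid C)) : Prop :=
  ∃ T ∈ distTriang C, isoCls C T.obj₁ = a ∧ isoCls C T.obj₂ = x ∧ isoCls C T.obj₃ = b

namespace IsExtension

theorem of_add (a b : Quotient (isIsomorphicSetoid C)) : IsExtension C a (a + b) b := by
  obtain ⟨A, rfl⟩ := Quotient.exists_rep a
  obtain ⟨B, rfl⟩ := Quotient.exists_rep b
  exact ⟨_, binaryBiproductTriangle_distinguished A B, rfl, rfl, rfl⟩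

theorem add {a x b a' x' b' : Quotient (isIsomorphicSetoid C)}
    (h : IsExtension C a x b) (h' : IsExtension C a' x' b') :
    IsExtension C (a + a') (x + x') (b + b') := by
  obtain ⟨T, hT, rfl, rfl, rfl⟩ := h
  obtain ⟨T', hT', rfl, rfl, rfl⟩ := h'
  exact ⟨productTriangle fun j => WalkingPair.casesOn j T T',
    productTriangle_distinguished _ (by rintro (_ | _) <;> assumption),
    isoCls_pi_walkingPair _, isoCls_pi_walkingPair _, isoCls_pi_walkingPair _⟩

theorem exists_triangle {A X B : C}
    (h : IsExtension C (isoCls C A) (isoCls C X) (isoCls C B)) :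
    ∃ (f : A ⟶ X) (g : X ⟶ B) (h : B ⟶ A⟦(1 : ℤ)⟧), Triangle.mk f g h ∈ distTriang C := by
  obtain ⟨T, hT, h₁, h₂, h₃⟩ := h
  obtain ⟨e₁⟩ := isoCls_eq_iff.1 h₁
  obtain ⟨e₂⟩ := isoCls_eq_iff.1 h₂
  obtain ⟨e₃⟩ := isoCls_eq_iff.1 h₃
  refine ⟨e₁.inv ≫ T.mor₁ ≫ e₂.hom, e₂.inv ≫ T.mor₂ ≫ e₃.hom,
    e₃.inv ≫ T.mor₃ ≫ e₁.hom⟦1⟧', isomorphic_distinguished _ hT _ ?_⟩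
  exact Triangle.isoMk _ _ e₁.symm e₂.symm e₃.symm
    (by change (e₁.inv ≫ T.mor₁ ≫ e₂.hom) ≫ e₂.inv = e₁.inv ≫ T.mor₁; simp)
    (by change (e₂.inv ≫ T.mor₂ ≫ e₃.hom) ≫ e₃.inv = e₂.inv ≫ T.mor₂; simp)
    (by
      change (e₃.inv ≫ T.mor₃ ≫ e₁.hom⟦1⟧') ≫ e₁.inv⟦1⟧' = e₃.inv ≫ T.mor₃
      simp [← Functor.map_comp])

end IsExtension

variable (C) in
/-- Heller's congruence: `x` and `y` are identified when, after adding a common summand, both are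
extensions of the same two classes. -/
def hellerCon : AddCon (Quotient (isIsomorphicSetoid C)) where
  r x y := ∃ a b s, IsExtension C a (x + s) b ∧ IsExtension C a (y + s) b
  iseqv := by
    refine ⟨fun x => ⟨x, 0, 0, .of_add _ _, .of_add _ _⟩,
      fun ⟨a, b, s, h, h'⟩ => ⟨a, b, s, h', h⟩, ?_⟩
    rintro x y z ⟨a, b, s, h₁, h₂⟩ ⟨a', b', s', h₁', h₂'⟩
    refine ⟨a + a', b + b', s + (y + s'), ?_, ?_⟩
    · rw [← add_assoc]
      exact h₁.add h₁'
    · convert h₂.add h₂' using 1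
      abel
  add' := by
    rintro w x y z ⟨a, b, s, h₁, h₂⟩ ⟨a', b', s', h₁', h₂'⟩
    refine ⟨a + a', b + b', s + s', ?_, ?_⟩
    · rw [add_add_add_comm]
      exact h₁.add h₁'
    · rw [add_add_add_comm]
      exact h₂.add h₂'

theorem hellerCon_apply {x y : Quotient (isIsomorphicSetoid C)} :
    hellerCon C x y ↔ ∃ a b s, IsExtension C a (x + s) b ∧ IsExtension C a (y + s) b :=
  Iff.rfl

instance : IsCancelAdd (hellerCon C).Quotient :=
  have : IsLeftCancelAdd (hellerCon C).Quotient := ⟨by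
    rintro ⟨w⟩ ⟨x⟩ ⟨y⟩ h
    obtain ⟨a, b, s, h₁, h₂⟩ := hellerCon_apply.1 ((hellerCon C).eq.1 h)
    refine (hellerCon C).eq.2 (hellerCon_apply.2 ⟨a, b, w + s, ?_, ?_⟩)
    · rwa [add_left_comm, ← add_assoc]
    · rwa [add_left_comm, ← add_assoc]⟩
  AddCommMagma.IsLeftCancelAdd.toIsCancelAdd _

/-- Heller's criterion for equality of classes in `K₀`. -/
theorem exists_triangles_of_mk_eq {X Y : C} (h : mk C X = mk C Y) :
    ∃ A B S : C,
      (∃ (f : A ⟶ X ⊞ S) (g : X ⊞ S ⟶ B) (h : B ⟶ A⟦(1 : ℤ)⟧),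
        Triangle.mk f g h ∈ distTriang C) ∧
      (∃ (f : A ⟶ Y ⊞ S) (g : Y ⊞ S ⟶ B) (h : B ⟶ A⟦(1 : ℤ)⟧),
        Triangle.mk f g h ∈ distTriang C) := by
  let φ := (Algebra.GrothendieckAddGroup.of (M := (hellerCon C).Quotient)).comp
    (hellerCon C).mk'
  have hφ : ∀ T ∈ distTriang C,
      φ (isoCls C T.obj₂) = φ (isoCls C T.obj₁) + φ (isoCls C T.obj₃) := by
    intro T hT
    rw [← map_add]
    refine congrArg Algebra.GrothendieckAddGroup.of ((hellerCon C).eq.2 ?_)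
    refine hellerCon_apply.2 ⟨isoCls C T.obj₁, isoCls C T.obj₃, 0, ?_, ?_⟩
    · rw [add_zero]
      exact ⟨T, hT, rfl, rfl, rfl⟩
    · rw [add_zero]
      exact .of_add _ _
  have hXY : φ (isoCls C X) = φ (isoCls C Y) := by
    simpa using congrArg (lift φ hφ) h
  obtain ⟨a, b, s, h₁, h₂⟩ := hellerCon_apply.1
    ((hellerCon C).eq.1 (Algebra.GrothendieckAddGroup.of_injective hXY))
  obtain ⟨A, rfl⟩ := Quotient.exists_rep a
  obtain ⟨B, rfl⟩ := Quotient.exists_rep b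
  obtain ⟨S, rfl⟩ := Quotient.exists_rep s
  exact ⟨A, B, S, h₁.exists_triangle, h₂.exists_triangle⟩

end K0

/-- `K₀` commutes with arbitrary products of pretriangulated categories: if the product
category `∀ i, C i` is equipped with a componentwise pretriangulated structure (the shift is
computed componentwise and a triangle is distinguished iff all its components are), then the
natural map `K₀ (∀ i, C i) ⟶ ∀ i, K₀ (C i)` induced by the projections is an isomorphism of
abelian groups. -/
theorem k0_pi {I : Type w} (C : I → Type u) [∀ i, Category.{v} (C i)]
    [∀ i, HasZeroObject (C i)] [∀ i, Preadditive (C i)] [∀ i, HasShift (C i) ℤ]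
    [∀ (i) (n : ℤ), (shiftFunctor (C i) n).Additive] [∀ i, Pretriangulated (C i)]
    [HasZeroObject (∀ i, C i)] [Preadditive (∀ i, C i)] [HasShift (∀ i, C i) ℤ]
    [∀ n : ℤ, (shiftFunctor (∀ i, C i) n).Additive] [Pretriangulated (∀ i, C i)]
    -- the shift on the product category is computed componentwise:
    (hshift : ∀ (X : ∀ i, C i) (i : I), (X⟦(1 : ℤ)⟧) i = (X i)⟦(1 : ℤ)⟧)
    (hshiftmap : ∀ {X Y : ∀ i, C i} (f : X ⟶ Y) (i : I),
      (f⟦(1 : ℤ)⟧') i ≫ eqToHom (hshift Y i) = eqToHom (hshift X i) ≫ (f i)⟦(1 : ℤ)⟧')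
    -- a triangle in the product category is distinguished iff each component is:
    (hdist : ∀ T : Triangle (∀ i, C i), (T ∈ distTriang (∀ i, C i)) ↔
      ∀ i, Triangle.mk (T.mor₁ i) (T.mor₂ i) (T.mor₃ i ≫ eqToHom (hshift T.obj₁ i))
        ∈ distTriang (C i)) :
    ∃ φ : K0 (∀ i, C i) ≃+ ∀ i, K0 (C i),
      ∀ X : ∀ i, C i, φ (K0.mk (∀ i, C i) X) = fun i => K0.mk (C i) (X i) := by
  have mk_pi_triangle : ∀ A X B : ∀ i, C i,
      (∀ i, ∃ (f : A i ⟶ X i) (g : X i ⟶ B i) (h : B i ⟶ (A i)⟦(1 : ℤ)⟧),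
        Triangle.mk f g h ∈ distTriang (C i)) →
      K0.mk (∀ i, C i) X = K0.mk (∀ i, C i) A + K0.mk (∀ i, C i) B := by
    intro A X B H
    choose f g h hT using H
    let T : Triangle (∀ i, C i) := Triangle.mk (X := A) (Y := X) (Z := B) f g
      fun i => h i ≫ eqToHom (hshift A i).symm
    refine K0.mk_triangle (T := T) ((hdist T).2 fun i => ?_)
    have e : (h i ≫ eqToHom (hshift A i).symm) ≫ eqToHom (hshift A i) = h i := by simp
    change Triangle.mk (f i) (g i)
      ((h i ≫ eqToHom (hshift A i).symm) ≫ eqToHom (hshift A i)) ∈ _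
    rw [e]
    exact hT i
  have mk_pi_biprod : ∀ X S : ∀ i, C i,
      K0.mk (∀ i, C i) (fun i => X i ⊞ S i) = K0.mk (∀ i, C i) X + K0.mk (∀ i, C i) S :=
    fun X S => mk_pi_triangle _ _ _ fun i =>
      ⟨_, _, _, binaryBiproductTriangle_distinguished (X i) (S i)⟩
  let proj : Quotient (isIsomorphicSetoid (∀ i, C i)) → ∀ i, K0 (C i) :=
    Quotient.lift (fun X i => K0.mk (C i) (X i))
      fun _ _ ⟨e⟩ => funext fun i => K0.mk_eq_of_iso (Pi.isoApp e i)
  let ψ : K0 (∀ i, C i) →+ ∀ i, K0 (C i) :=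
    K0.lift proj fun T hT => funext fun i => K0.mk_triangle ((hdist T).1 hT i)
  have hψ : ∀ X : ∀ i, C i, ψ (K0.mk (∀ i, C i) X) = fun i => K0.mk (C i) (X i) :=
    fun X => K0.lift_mk _ _ X
  refine ⟨AddEquiv.ofBijective ψ ⟨fun x y hxy => ?_, fun y => ?_⟩, hψ⟩
  · obtain ⟨X, rfl⟩ := K0.mk_surjective x
    obtain ⟨Y, rfl⟩ := K0.mk_surjective y
    rw [hψ, hψ] at hxy
    choose A B S hX hY using fun i => K0.exists_triangles_of_mk_eq (congrFun hxy i)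
    have h := (mk_pi_triangle _ _ _ hX).trans (mk_pi_triangle _ _ _ hY).symm
    rw [mk_pi_biprod, mk_pi_biprod] at h
    exact add_right_cancel h
  · choose X hX using fun i => K0.mk_surjective (y i)
    exact ⟨K0.mk _ X, (hψ X).trans (funext hX)⟩
end

section
/- Let {C_i}_{i ∈ I} be an arbitrary family of categories and, for each i, let W_i be a class of morphisms in C_i that admits a left calculus of fractions. Let W denote the componentwise class of morphisms on the product category ∏_{i ∈ I} C_i (a morphism (f_i)_i lies in W iff each f_i lies in W_i). Then the functor ∏_{i ∈ I} C_i ⥤ ∏_{i ∈ I} C_i[W_i⁻¹], given componentwise by the localization functors, exhibits ∏_{i ∈ I} C_i[W_i⁻¹] as the localization of ∏_{i ∈ I} C_i at W; equivalently, the canonical functor (∏_{i ∈ I} C_i)[W⁻¹] ⟶ ∏_{i ∈ I} C_i[W_i⁻¹] is an equivalence of categories. -/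
open CategoryTheory

universe w v u v' u'

/-- The componentwise class of morphisms on a product category admits a left calculus of
fractions if each component does. -/
instance CategoryTheory.MorphismProperty.pi_hasLeftCalculusOfFractions {I : Type w}
    {C : I → Type u} [∀ i, Category.{v} (C i)] (W : ∀ i, MorphismProperty (C i))
    [∀ i, (W i).HasLeftCalculusOfFractions] :
    (MorphismProperty.pi W).HasLeftCalculusOfFractions where
  id_mem X i := (W i).id_mem (X i)
  comp_mem f g hf hg i := (W i).comp_mem (f i) (g i) (hf i) (hg i)
  exists_leftFraction X Y φ := by
    choose ψ hψ using fun i =>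
      (MorphismProperty.RightFraction.mk (φ.s i) (φ.hs i) (φ.f i)).exists_leftFraction
    exact ⟨.mk (Y' := fun i => (ψ i).Y') (fun i => (ψ i).f) (fun i => (ψ i).s)
      (fun i => (ψ i).hs), funext hψ⟩
  ext X' X Y f₁ f₂ s hs h := by
    choose Z t ht hft using fun i =>
      MorphismProperty.HasLeftCalculusOfFractions.ext (W := W i) (f₁ i) (f₂ i) (s i) (hs i)
        (congrFun h i)
    exact ⟨Z, t, ht, funext hft⟩

/-- A recognition criterion for localization functors with respect to a class of morphisms
admitting a left calculus of fractions. -/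
theorem CategoryTheory.Functor.IsLocalization.of_leftFraction {C : Type*} [Category* C]
    {D : Type*} [Category* D] (L : C ⥤ D) (W : MorphismProperty C)
    [W.HasLeftCalculusOfFractions] [L.EssSurj] (hL : W.IsInvertedBy L)
    (hfrac : ∀ ⦃X Y : C⦄ (f : L.obj X ⟶ L.obj Y), ∃ φ : W.LeftFraction X Y, f = φ.map L hL)
    (hext : ∀ ⦃X Y : C⦄ (f₁ f₂ : X ⟶ Y), L.map f₁ = L.map f₂ →
      ∃ (Z : C) (s : Y ⟶ Z) (_ : W s), f₁ ≫ s = f₂ ≫ s) :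
    L.IsLocalization W := by
  obtain ⟨G, rfl⟩ : ∃ G : W.Localization ⥤ D, L = W.Q ⋙ G :=
    ⟨_, (Localization.Construction.fac L hL).symm⟩
  have hobj : Function.Surjective W.Q.obj := (Localization.Construction.objEquiv W).surjective
  have : G.EssSurj :=
    ⟨fun Y => ⟨W.Q.obj ((W.Q ⋙ G).objPreimage Y), ⟨(W.Q ⋙ G).objObjPreimageIso Y⟩⟩⟩
  have : G.Full := by
    refine ⟨fun {X Y} f => ?_⟩
    obtain ⟨X, rfl⟩ := hobj X
    obtain ⟨Y, rfl⟩ := hobj Y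
    obtain ⟨φ, rfl⟩ := hfrac f
    have := hL _ φ.hs
    refine ⟨φ.map W.Q (Localization.inverts W.Q W), ?_⟩
    rw [← cancel_mono ((W.Q ⋙ G).map φ.s), φ.map_comp_map_s (W.Q ⋙ G) hL, Functor.comp_map,
      ← G.map_comp, φ.map_comp_map_s, Functor.comp_map]
  have : G.Faithful := by
    refine ⟨fun {X Y} a b h => ?_⟩
    obtain ⟨X, rfl⟩ := hobj X
    obtain ⟨Y, rfl⟩ := hobj Y
    obtain ⟨φ, rfl, rfl⟩ := Localization.exists_leftFraction₂ W.Q W a b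
    have := Localization.inverts W.Q W _ φ.hs
    have h' : (W.Q ⋙ G).map φ.f = (W.Q ⋙ G).map φ.f' := by
      have := congr($h ≫ G.map (W.Q.map φ.s))
      rw [← G.map_comp, ← G.map_comp] at this
      erw [φ.fst.map_comp_map_s, φ.snd.map_comp_map_s] at this
      exact this
    obtain ⟨Z, s, hs, hfs⟩ := hext _ _ h'
    have hQ : W.Q.map φ.f = W.Q.map φ.f' :=
      (MorphismProperty.map_eq_iff_postcomp W.Q W _ _).2 ⟨Z, s, hs, hfs⟩
    exact congr($hQ ≫ CategoryTheory.inv (W.Q.map φ.s))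
  have : G.IsEquivalence := { }
  infer_instance

/-- Localization commutes with arbitrary products for classes of morphisms admitting a left
calculus of fractions: the componentwise localization functor exhibits the product of the
localized categories as the localization of the product category at the componentwise class
of morphisms. -/
theorem pi_isLocalization {I : Type w} (C : I → Type u) [∀ i, Category.{v} (C i)]
    (D : I → Type u') [∀ i, Category.{v'} (D i)]
    (W : ∀ i, MorphismProperty (C i)) [∀ i, (W i).HasLeftCalculusOfFractions]
    (L : ∀ i, C i ⥤ D i) [∀ i, (L i).IsLocalization (W i)] :
    (Functor.pi L).IsLocalization (MorphismProperty.pi W) := by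
  have hL : (MorphismProperty.pi W).IsInvertedBy (Functor.pi L) :=
    MorphismProperty.IsInvertedBy.pi _ _ fun i => Localization.inverts (L i) (W i)
  have (i : I) : (L i).EssSurj := Localization.essSurj (L i) (W i)
  have : (Functor.pi L).EssSurj :=
    ⟨fun Y => ⟨fun i => (L i).objPreimage (Y i),
      ⟨Pi.isoMk fun i => (L i).objObjPreimageIso (Y i)⟩⟩⟩
  refine .of_leftFraction _ _ hL (fun X Y f => ?_) (fun X Y f₁ f₂ h => ?_)
  · choose φ hφ using fun i => Localization.exists_leftFraction (L i) (W i) (f i)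
    let ψ : (MorphismProperty.pi W).LeftFraction X Y :=
      .mk (Y' := fun i => (φ i).Y') (fun i => (φ i).f) (fun i => (φ i).s) (fun i => (φ i).hs)
    have := hL _ ψ.hs
    refine ⟨ψ, ?_⟩
    rw [← cancel_mono ((Functor.pi L).map ψ.s), ψ.map_comp_map_s]
    funext i
    exact congr($(hφ i) ≫ (L i).map (φ i).s).trans ((φ i).map_comp_map_s (L i) _)
  · choose Z s hs hfs using fun i =>
      (MorphismProperty.map_eq_iff_postcomp (L i) (W i) (f₁ i) (f₂ i)).1 (congrFun h i)
    exact ⟨Z, s, hs, funext hfs⟩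
end
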